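/- arXiv:0907.3859 — 2 statements merged into one kernel-verified Lean document; each statement's English description precedes it below -/
import Mathlib

section
/- Let P(λ) = A_m λ^m + ⋯ + A_1 λ + A_0 be an n×n complex matrix polynomial with det A_m ≠ 0 and let λ0 be an eigenvalue of P. Suppose there exist integers p0 ≥ 1, κ0 ≥ 1 with κ0·p0 ≤ nm, matrices X ∈ ℂ^{n×nm}, Y ∈ ℂ^{nm×n}, and J = J_1 ⊕ ⋯ ⊕ J_{κ0} ⊕ J̃ ∈ ℂ^{nm×nm}, where each J_i = λ0 I_{p0} + N with N the p0×p0 nilpotent Jordan block (ones on the superdiagonal), such that P(μ)^{−1} = X (μ I_{nm} − J)^{−1} Y for every μ with det P(μ) ≠ 0, and (μ − λ0)^{p0} (μ I − J̃)^{−1} → 0 as μ → λ0. Then, as μ → λ0 through points with det P(μ) ≠ 0, |μ − λ0|^{p0} · ‖P(μ)^{−1}‖ → ‖X D Y‖, where D = N^{p0−1} ⊕ ⋯ ⊕ N^{p0−1} ⊕ 0 (κ0 copies of N^{p0−1} followed by the zero block of size nm − κ0 p0). -/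
noncomputable section

open Matrix

/-- Euclidean norm of a complex vector. -/
def enorm2 {n : ℕ} (x : Fin n → ℂ) : ℝ := Real.sqrt (∑ i, ‖x i‖ ^ 2)

/-- Spectral norm: the operator norm induced by the Euclidean vector norm. -/
def specNorm {n : ℕ} (A : Matrix (Fin n) (Fin n) ℂ) : ℝ :=
  sSup {r : ℝ | ∃ x : Fin n → ℂ, enorm2 x = 1 ∧ r = enorm2 (A.mulVec x)}

/-- Smallest singular value: the minimum of `‖A x‖` over Euclidean-unit vectors `x`. -/
def sminSV {n : ℕ} (A : Matrix (Fin n) (Fin n) ℂ) : ℝ :=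
  sInf {r : ℝ | ∃ x : Fin n → ℂ, enorm2 x = 1 ∧ r = enorm2 (A.mulVec x)}

/-- Evaluation of the matrix polynomial `P(z) = ∑ A_j z^j`. -/
def evalP {n m : ℕ} (A : Fin (m+1) → Matrix (Fin n) (Fin n) ℂ) (z : ℂ) :
    Matrix (Fin n) (Fin n) ℂ :=
  ∑ j : Fin (m+1), z ^ (j : ℕ) • A j

/-- Derivative `P'(z) = ∑_{j≥1} j A_j z^(j-1)`. -/
def derivP {n m : ℕ} (A : Fin (m+1) → Matrix (Fin n) (Fin n) ℂ) (z : ℂ) :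
    Matrix (Fin n) (Fin n) ℂ :=
  ∑ j : Fin (m+1), (((j : ℕ) : ℂ) * z ^ ((j : ℕ) - 1)) • A j

/-- The scalar polynomial `det P(λ)`. -/
def detPoly {n m : ℕ} (A : Fin (m+1) → Matrix (Fin n) (Fin n) ℂ) : Polynomial ℂ :=
  (Matrix.of fun i k => ∑ j : Fin (m+1), Polynomial.C (A j i k) * Polynomial.X ^ (j : ℕ)).det

/-- The weight polynomial `w(t) = ∑ w_j t^j`. -/
def wval {m : ℕ} (w : Fin (m+1) → ℝ) (t : ℝ) : ℝ := ∑ j : Fin (m+1), w j * t ^ (j : ℕ)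

/-- The `p × p` nilpotent Jordan block (ones on the superdiagonal). -/
def jordanN (p : ℕ) : Matrix (Fin p) (Fin p) ℂ :=
  Matrix.of fun a b => if (b : ℕ) = (a : ℕ) + 1 then 1 else 0

/-- `J = J_1 ⊕ ⋯ ⊕ J_{κ0} ⊕ J̃` with `κ0` Jordan blocks `λ0 I + N` of size `p0`. -/
def bigJ (lam0 : ℂ) (p0 κ0 q : ℕ) (Jt : Matrix (Fin q) (Fin q) ℂ) :
    Matrix ((Fin p0 × Fin κ0) ⊕ Fin q) ((Fin p0 × Fin κ0) ⊕ Fin q) ℂ :=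
  Matrix.fromBlocks
    (Matrix.blockDiagonal fun _ : Fin κ0 => lam0 • (1 : Matrix (Fin p0) (Fin p0) ℂ) + jordanN p0)
    0 0 Jt

/-- `D = N^{p0−1} ⊕ ⋯ ⊕ N^{p0−1} ⊕ 0` (`κ0` copies, then a zero block of size `q`). -/
def bigD (p0 κ0 q : ℕ) :
    Matrix ((Fin p0 × Fin κ0) ⊕ Fin q) ((Fin p0 × Fin κ0) ⊕ Fin q) ℂ :=
  Matrix.fromBlocks
    (Matrix.blockDiagonal fun _ : Fin κ0 => (jordanN p0) ^ (p0 - 1))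
    0 0 0

lemma jN_pow (p k : ℕ) : ∀ a b : Fin p, ((jordanN p) ^ k) a b ≠ 0 → (a : ℕ) + k ≤ b := by
  induction k with
  | zero =>
    intro a b h
    by_cases hab : a = b
    · simp [hab]
    · simp [Matrix.one_apply, hab] at h
  | succ k ih =>
    intro a b h
    rw [pow_succ, Matrix.mul_apply] at h
    obtain ⟨c, -, hc⟩ := Finset.exists_ne_zero_of_sum_ne_zero h
    have h1 := ih a c (left_ne_zero_of_mul hc)
    have h2 := right_ne_zero_of_mul hc
    simp only [jordanN, Matrix.of_apply, ne_eq, ite_eq_right_iff, one_ne_zero, imp_false,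
      not_not] at h2
    omega

lemma jN_nil (p : ℕ) : (jordanN p) ^ p = 0 := by
  ext a b
  by_contra h
  have := jN_pow p p a b h
  have := b.2
  omega

def Gm (p : ℕ) (z : ℂ) : Matrix (Fin p) (Fin p) ℂ :=
  ∑ i ∈ Finset.range p, (z • (1 : Matrix (Fin p) (Fin p) ℂ)) ^ i * (jordanN p) ^ (p - 1 - i)

lemma Gm_mul (p : ℕ) (z : ℂ) :
    (z • (1 : Matrix (Fin p) (Fin p) ℂ) - jordanN p) * Gm p z = z ^ p • 1 := by
  have hc : Commute (z • (1 : Matrix (Fin p) (Fin p) ℂ)) (jordanN p) :=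
    (Commute.one_left _).smul_left z
  rw [Gm, hc.mul_geom_sum₂, jN_nil, smul_pow, one_pow, sub_zero]

lemma Gm_cont (p : ℕ) : Continuous (Gm p) := by
  unfold Gm
  fun_prop

lemma Gm_zero (p : ℕ) (hp : 1 ≤ p) : Gm p 0 = (jordanN p) ^ (p - 1) := by
  rw [Gm, Finset.sum_eq_single 0]
  · simp
  · intro i _ hi
    simp [hi]
  · intro h
    simp at h
    omega

lemma res_eq (lam0 μ : ℂ) (p κ q : ℕ) (Jt : Matrix (Fin q) (Fin q) ℂ) (hz : μ - lam0 ≠ 0)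
    (hd : (μ • (1 : Matrix (Fin q) (Fin q) ℂ) - Jt).det ≠ 0) :
    (μ - lam0) ^ p • (μ • (1 : Matrix ((Fin p × Fin κ) ⊕ Fin q) ((Fin p × Fin κ) ⊕ Fin q) ℂ) -
          bigJ lam0 p κ q Jt)⁻¹ =
    Matrix.fromBlocks (Matrix.blockDiagonal fun _ : Fin κ => Gm p (μ - lam0)) 0 0
      ((μ - lam0) ^ p • (μ • (1 : Matrix (Fin q) (Fin q) ℂ) - Jt)⁻¹) := by
  have hzp : (μ - lam0) ^ p ≠ 0 := pow_ne_zero _ hz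
  have e1 : μ • (1 : Matrix ((Fin p × Fin κ) ⊕ Fin q) ((Fin p × Fin κ) ⊕ Fin q) ℂ) -
          bigJ lam0 p κ q Jt = Matrix.fromBlocks
      (Matrix.blockDiagonal fun _ : Fin κ => (μ - lam0) • (1 : Matrix (Fin p) (Fin p) ℂ) - jordanN p)
      0 0 (μ • (1 : Matrix (Fin q) (Fin q) ℂ) - Jt) := by
    have e2 : (Matrix.blockDiagonal fun _ : Fin κ =>
        (μ - lam0) • (1 : Matrix (Fin p) (Fin p) ℂ) - jordanN p) =
        μ • (1 : Matrix (Fin p × Fin κ) (Fin p × Fin κ) ℂ) - Matrix.blockDiagonal fun _ : Fin κ =>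
          lam0 • (1 : Matrix (Fin p) (Fin p) ℂ) + jordanN p := by
      rw [← Matrix.blockDiagonal_one, ← Matrix.blockDiagonal_smul, ← Matrix.blockDiagonal_sub]
      congr 1
      funext i
      simp only [Pi.sub_apply, Pi.smul_apply, Pi.one_apply, sub_smul]
      abel
    rw [e2, bigJ, ← Matrix.fromBlocks_one, Matrix.fromBlocks_smul, sub_eq_add_neg, Matrix.fromBlocks_neg,
      Matrix.fromBlocks_add]
    simp [sub_eq_add_neg]
  have key : (μ • (1 : Matrix ((Fin p × Fin κ) ⊕ Fin q) ((Fin p × Fin κ) ⊕ Fin q) ℂ) -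
          bigJ lam0 p κ q Jt) *
      Matrix.fromBlocks (Matrix.blockDiagonal fun _ : Fin κ => Gm p (μ - lam0)) 0 0
      ((μ - lam0) ^ p • (μ • (1 : Matrix (Fin q) (Fin q) ℂ) - Jt)⁻¹) = (μ - lam0) ^ p • 1 := by
    rw [e1, Matrix.fromBlocks_multiply, ← Matrix.blockDiagonal_mul]
    simp only [Gm_mul]
    have e3 : (Matrix.blockDiagonal fun _ : Fin κ =>
        (μ - lam0) ^ p • (1 : Matrix (Fin p) (Fin p) ℂ)) = (μ - lam0) ^ p • 1 := by
      rw [← Matrix.blockDiagonal_one, ← Matrix.blockDiagonal_smul]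
      rfl
    rw [e3, Matrix.mul_smul (μ • (1 : Matrix (Fin q) (Fin q) ℂ) - Jt), Matrix.mul_nonsing_inv _ (isUnit_iff_ne_zero.mpr hd),
      ← Matrix.fromBlocks_one, Matrix.fromBlocks_smul]
    simp
  rw [Matrix.inv_eq_right_inv (B := ((μ - lam0) ^ p)⁻¹ • Matrix.fromBlocks (Matrix.blockDiagonal fun _ : Fin κ => Gm p (μ - lam0)) 0 0
      ((μ - lam0) ^ p • (μ • (1 : Matrix (Fin q) (Fin q) ℂ) - Jt)⁻¹))
      (by rw [Matrix.mul_smul, key, inv_smul_smul₀ hzp]), smul_inv_smul₀ hzp]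

open scoped Matrix.Norms.L2Operator in
lemma specNorm_eq {n : ℕ} (A : Matrix (Fin n) (Fin n) ℂ) : specNorm A = ‖A‖ := by
  have hn : ∀ x : EuclideanSpace ℂ (Fin n), enorm2 x.ofLp = ‖x‖ := by
    intro x
    rw [EuclideanSpace.norm_eq]; rfl
  rcases Nat.eq_zero_or_pos n with rfl | hpos
  · have : A = 0 := Subsingleton.elim _ _
    subst this
    simp [specNorm, enorm2]
  haveI : Nonempty (Fin n) := ⟨⟨0, hpos⟩⟩
  rw [Matrix.cstar_norm_def, ← ContinuousLinearMap.sSup_sphere_eq_norm, specNorm]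
  congr 1
  ext r
  constructor
  · rintro ⟨x, hx, rfl⟩
    refine ⟨WithLp.toLp 2 x, ?_, ?_⟩
    · rw [mem_sphere_zero_iff_norm, ← hn]; exact hx
    · simp only
      rw [← hn, Matrix.ofLp_toEuclideanCLM]
  · rintro ⟨x, hx, rfl⟩
    refine ⟨x.ofLp, ?_, ?_⟩
    · rw [hn]; exact mem_sphere_zero_iff_norm.1 hx
    · simp only
      rw [← hn, Matrix.ofLp_toEuclideanCLM]

open scoped Matrix.Norms.L2Operator in
lemma specNorm_cont {n : ℕ} : Continuous (specNorm (n := n)) := by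
  have : (specNorm (n := n)) = fun A => ‖A‖ := funext specNorm_eq
  rw [this]
  exact continuous_norm

open scoped Matrix.Norms.L2Operator in
lemma specNorm_smul {n : ℕ} (c : ℂ) (A : Matrix (Fin n) (Fin n) ℂ) :
    specNorm (c • A) = ‖c‖ * specNorm A := by
  rw [specNorm_eq, specNorm_eq, norm_smul]

lemma det_ev {q : ℕ} (Jt : Matrix (Fin q) (Fin q) ℂ) (lam0 : ℂ) :
    ∀ᶠ μ in nhdsWithin lam0 {lam0}ᶜ, (μ • (1 : Matrix (Fin q) (Fin q) ℂ) - Jt).det ≠ 0 := by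
  have hf : (Jt.charpoly.rootSet ℂ).Finite := Polynomial.rootSet_finite _ _
  have h2 : ∀ᶠ μ in nhdsWithin lam0 {lam0}ᶜ, μ ∉ Jt.charpoly.rootSet ℂ := by
    have h3 := (hf.sdiff (t := {lam0})).isClosed.isOpen_compl.mem_nhds
      (x := lam0) (by simp)
    filter_upwards [mem_nhdsWithin_of_mem_nhds h3, self_mem_nhdsWithin] with μ h4 h5 h6
    exact h4 ⟨h6, h5⟩
  filter_upwards [h2] with μ hμ h0
  apply hμ
  rw [Polynomial.mem_rootSet]
  refine ⟨Jt.charpoly_monic.ne_zero, ?_⟩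
  rw [Polynomial.coe_aeval_eq_eval, Matrix.eval_charpoly, ← h0, Matrix.smul_one_eq_diagonal]
  rfl

/-- key growth estimate in the proof of Theorem 3.2: as `μ → λ0`
through points with `det P(μ) ≠ 0`, `|μ − λ0|^{p0} ‖P(μ)^{−1}‖ → ‖X D Y‖`. -/
theorem stmt10 {n m : ℕ}
    (A : Fin (m+1) → Matrix (Fin n) (Fin n) ℂ)
    (hAm : (A (Fin.last m)).det ≠ 0)
    (lam0 : ℂ) (heig : (evalP A lam0).det = 0)
    (p0 κ0 q : ℕ) (hp0 : 1 ≤ p0) (hκ0 : 1 ≤ κ0) (hq : κ0 * p0 + q = n * m)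
    (X : Matrix (Fin n) ((Fin p0 × Fin κ0) ⊕ Fin q) ℂ)
    (Y : Matrix ((Fin p0 × Fin κ0) ⊕ Fin q) (Fin n) ℂ)
    (Jt : Matrix (Fin q) (Fin q) ℂ)
    (hres : ∀ μ : ℂ, (evalP A μ).det ≠ 0 →
      (evalP A μ)⁻¹ =
        X * (μ • (1 : Matrix ((Fin p0 × Fin κ0) ⊕ Fin q) ((Fin p0 × Fin κ0) ⊕ Fin q) ℂ) -
          bigJ lam0 p0 κ0 q Jt)⁻¹ * Y)
    (htilde : Filter.Tendsto
      (fun μ : ℂ => (μ - lam0) ^ p0 •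
        (μ • (1 : Matrix (Fin q) (Fin q) ℂ) - Jt)⁻¹)
      (nhdsWithin lam0 {lam0}ᶜ) (nhds 0)) :
    Filter.Tendsto
      (fun μ : ℂ => ‖μ - lam0‖ ^ p0 * specNorm ((evalP A μ)⁻¹))
      (nhdsWithin lam0 {μ : ℂ | (evalP A μ).det ≠ 0})
      (nhds (specNorm (X * bigD p0 κ0 q * Y))) := by
  have hsub : {μ : ℂ | (evalP A μ).det ≠ 0} ⊆ {lam0}ᶜ := by
    rintro μ hμ rfl
    exact hμ heig
  have hle := nhdsWithin_mono lam0 hsub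
  have hG : Filter.Tendsto (fun μ : ℂ => Gm p0 (μ - lam0))
      (nhdsWithin lam0 {μ : ℂ | (evalP A μ).det ≠ 0}) (nhds ((jordanN p0) ^ (p0 - 1))) := by
    rw [← Gm_zero p0 hp0, ← sub_self lam0]
    exact (((Gm_cont p0).comp (continuous_id.sub continuous_const)).tendsto lam0).mono_left
      nhdsWithin_le_nhds
  have hF : Continuous (fun w : Matrix (Fin p0) (Fin p0) ℂ × Matrix (Fin q) (Fin q) ℂ =>
      specNorm (X * Matrix.fromBlocks (Matrix.blockDiagonal fun _ : Fin κ0 => w.1) 0 0 w.2 * Y)) := by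
    apply specNorm_cont.comp
    refine (continuous_const.matrix_mul (Continuous.matrix_fromBlocks
      (Continuous.matrix_blockDiagonal (continuous_pi fun _ => continuous_fst))
      continuous_const continuous_const continuous_snd)).matrix_mul continuous_const
  have hT := (hF.tendsto ((jordanN p0) ^ (p0 - 1), 0)).comp
    (hG.prodMk_nhds (htilde.mono_left hle))
  refine Filter.Tendsto.congr' ?_ hT
  filter_upwards [self_mem_nhdsWithin, (det_ev Jt lam0).filter_mono hle] with μ h1 h2
  have hz : μ - lam0 ≠ 0 := sub_ne_zero.mpr (hsub h1)
  simp only [Function.comp]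
  rw [← res_eq lam0 μ p0 κ0 q Jt hz h2, hres μ h1, ← norm_pow, ← specNorm_smul,
    Matrix.mul_smul, Matrix.smul_mul]
end
end

section
/- Let P(λ) = A_m λ^m + ⋯ + A_1 λ + A_0 be an n×n complex matrix polynomial, let w_0, …, w_m be nonnegative reals with w(t) = Σ w_j t^j, let ε > 0, and let Δ_0, …, Δ_m ∈ ℂ^{n×n} satisfy ‖Δ_j‖ ≤ ε w_j for all j. If μ ∈ ℂ satisfies det Q(μ) = 0, where Q(λ) = Σ_{j=0}^m (A_j + Δ_j) λ^j, then |det P(μ)| ≤ ε · w(|μ|) · ‖P(μ)‖^{n−1}. -/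
noncomputable section

open Matrix

theorem aux_enorm2 {n : ℕ} (x : Fin n → ℂ) : enorm2 x = ‖(WithLp.toLp 2 x : EuclideanSpace ℂ (Fin n))‖ := by
  simp [enorm2, EuclideanSpace.norm_eq]

theorem aux_le_spec {n : ℕ} (A : Matrix (Fin n) (Fin n) ℂ) (u : EuclideanSpace ℂ (Fin n))
    (hu : ‖u‖ = 1) : ‖Matrix.toEuclideanCLM (n := Fin n) (𝕜 := ℂ) A u‖ ≤ specNorm A := by
  apply le_csSup
  · refine ⟨‖Matrix.toEuclideanCLM (n := Fin n) (𝕜 := ℂ) A‖, ?_⟩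
    rintro r ⟨x, hx, rfl⟩
    rw [aux_enorm2] at hx ⊢
    rw [← Matrix.toEuclideanCLM_toLp]
    exact ContinuousLinearMap.unit_le_opNorm _ _ hx.le
  · refine ⟨u.ofLp, ?_, ?_⟩
    · rw [aux_enorm2]; exact hu
    · rw [aux_enorm2, ← Matrix.toEuclideanCLM_toLp]

theorem aux_hadamard {n : ℕ} (u : OrthonormalBasis (Fin n) ℂ (EuclideanSpace ℂ (Fin n)))
    (v : Fin n → EuclideanSpace ℂ (Fin n)) : ‖u.toBasis.det v‖ ≤ ∏ i, ‖v i‖ := by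
  have hc : Module.finrank ℂ (EuclideanSpace ℂ (Fin n)) = Fintype.card (Fin n) := by simp
  let b := InnerProductSpace.gramSchmidtOrthonormalBasis hc v
  have hb : b.toBasis.det v = ∏ i, inner ℂ (b i) (v i) :=
    InnerProductSpace.gramSchmidtOrthonormalBasis_det hc v
  have h1 := congrArg (fun f => f v) (AlternatingMap.eq_smul_basis_det b.toBasis u.toBasis.det)
  simp only [AlternatingMap.smul_apply, smul_eq_mul, OrthonormalBasis.coe_toBasis] at h1
  rw [h1, norm_mul, OrthonormalBasis.det_to_matrix_orthonormalBasis, one_mul, hb, norm_prod]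
  apply Finset.prod_le_prod
  · intro i _
    positivity
  intro i _
  have := norm_inner_le_norm (𝕜 := ℂ) (b i) (v i)
  rwa [b.orthonormal.1 i, one_mul] at this

theorem aux_det {n : ℕ} (A : Matrix (Fin n) (Fin n) ℂ)
    (u : OrthonormalBasis (Fin n) ℂ (EuclideanSpace ℂ (Fin n))) :
    ‖A.det‖ ≤ ∏ i, ‖Matrix.toEuclideanCLM (n := Fin n) (𝕜 := ℂ) A (u i)‖ := by
  have h := aux_hadamard u ((Matrix.toEuclideanLin A) ∘ u.toBasis)
  rw [Module.Basis.det_comp, Module.Basis.det_self, mul_one] at h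
  have e : LinearMap.det (Matrix.toEuclideanLin A) = A.det := by
    rw [Matrix.toEuclideanLin_eq_toLin, LinearMap.det_toLin]
  rw [e] at h
  simp only [Function.comp_apply, OrthonormalBasis.coe_toBasis] at h
  exact h

/-- Hadamard step in the proof of Theorem 6.1: if `μ` is an
eigenvalue of the perturbed polynomial `Q = ∑ (A_j + Δ_j) λ^j` with `‖Δ_j‖ ≤ ε w_j`,
then `|det P(μ)| ≤ ε w(|μ|) ‖P(μ)‖^{n−1}`. -/
theorem stmt15 {n m : ℕ}
    (A Δ : Fin (m+1) → Matrix (Fin n) (Fin n) ℂ)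
    (w : Fin (m+1) → ℝ) (hw : ∀ j, 0 ≤ w j)
    (ε : ℝ) (hε : 0 < ε)
    (hΔ : ∀ j, specNorm (Δ j) ≤ ε * w j)
    (μ : ℂ) (hQ : (evalP (fun j => A j + Δ j) μ).det = 0) :
    ‖(evalP A μ).det‖ ≤
      ε * wval w ‖μ‖ * specNorm (evalP A μ) ^ (n - 1) := by
  classical
  obtain ⟨v, hv0, hv⟩ := Matrix.exists_mulVec_eq_zero_iff.mpr hQ
  have hn : 0 < n := by
    rcases Nat.eq_zero_or_pos n with rfl | h
    · exact absurd (Subsingleton.elim v 0) hv0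
    · exact h
  let i0 : Fin n := ⟨0, hn⟩
  let V : EuclideanSpace ℂ (Fin n) := WithLp.toLp 2 v
  have hV : V ≠ 0 := by simpa [V] using hv0
  let e : EuclideanSpace ℂ (Fin n) := ((‖V‖⁻¹ : ℝ) : ℂ) • V
  have he : ‖e‖ = 1 := by
    simp [e, norm_smul, hV]
  have hon : Orthonormal ℂ (({i0} : Set (Fin n)).domRestrict (fun _ => e)) := by
    refine ⟨fun _ => he, fun i j hij => absurd (Subsingleton.elim i j) hij⟩
  obtain ⟨u, hu⟩ := hon.exists_orthonormalBasis_extension_of_card_eq (by simp)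
  have hu0 : u i0 = e := hu i0 rfl
  let T := Matrix.toEuclideanCLM (n := Fin n) (𝕜 := ℂ)
  have hQe : T (evalP (fun j => A j + Δ j) μ) e = 0 := by
    simp only [e, map_smul, V, T, Matrix.toEuclideanCLM_toLp, hv]
    simp
  have hsplit : evalP (fun j => A j + Δ j) μ = evalP A μ + ∑ j : Fin (m+1), μ ^ (j : ℕ) • Δ j := by
    simp [evalP, Finset.sum_add_distrib]
  have hP : T (evalP A μ) e = - ∑ j : Fin (m+1), μ ^ (j : ℕ) • T (Δ j) e := by
    rw [hsplit, map_add, ContinuousLinearMap.add_apply] at hQe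
    rw [eq_neg_of_add_eq_zero_left hQe, map_sum, ContinuousLinearMap.sum_apply]
    simp
  have hbound : ‖T (evalP A μ) e‖ ≤ ε * wval w ‖μ‖ := by
    rw [hP, norm_neg, wval, Finset.mul_sum]
    refine (norm_sum_le _ _).trans (Finset.sum_le_sum fun j _ => ?_)
    rw [norm_smul, norm_pow]
    calc ‖μ‖ ^ (j : ℕ) * ‖T (Δ j) e‖ ≤ ‖μ‖ ^ (j : ℕ) * (ε * w j) := by
          gcongr
          exact (aux_le_spec _ _ he).trans (hΔ j)
      _ = _ := by ring
  have hS : ∀ i, ‖T (evalP A μ) (u i)‖ ≤ specNorm (evalP A μ) :=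
    fun i => aux_le_spec _ _ (u.orthonormal.1 i)
  refine (aux_det _ u).trans ?_
  rw [← Finset.mul_prod_erase _ _ (Finset.mem_univ i0), hu0]
  have hprod : ∏ i ∈ Finset.univ.erase i0, ‖T (evalP A μ) (u i)‖
      ≤ specNorm (evalP A μ) ^ (n - 1) := by
    refine (Finset.prod_le_prod (fun i _ => norm_nonneg _) (fun i _ => hS i)).trans ?_
    simp
  exact mul_le_mul hbound hprod (Finset.prod_nonneg fun i _ => norm_nonneg _)
    ((norm_nonneg _).trans hbound)
end
end
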